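/- arXiv:2407.07131 — 9 statements merged into one kernel-verified Lean document; each statement's English description precedes it below -/
import Mathlib

section
/- For every i ∈ {1, …, n−2} write f^{(n)}(a_i; a_1, …, â_i, …, a_{n−2}) = ∑_{T} 1/∏_{t∈T}(ζ_{a_i} − ζ_{a_t}), the sum over all subsets T ⊆ {1,…,n−2}∖{i} of size ⌊n/2⌋. Then ∑_{i=1}^{n−2} f^{(n)}(a_i; a_1, …, â_i, …, a_{n−2}) · ζ_{a_i}^m = 0 for every m = 0, 1, …, ⌊n/2⌋ − 1. -/
/-- The divided difference of `X ^ m` over more than `m + 1` distinct nodes vanishes. -/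
theorem sum_inv_prod_sub_mul_pow_eq_zero {F ι : Type*} [Field F] [DecidableEq ι]
    {v : ι → F} (hv : Function.Injective v) (s : Finset ι) {m : ℕ} (hm : m + 1 < s.card) :
    ∑ i ∈ s, (∏ t ∈ s.erase i, (v i - v t))⁻¹ * v i ^ m = 0 := by
  have hdeg : (Polynomial.X ^ m : Polynomial F).degree < s.card := by
    rw [Polynomial.degree_X_pow]
    exact_mod_cast (by omega : m < s.card)
  have h := Lagrange.coeff_eq_sum hv.injOn hdeg
  rw [Polynomial.coeff_X_pow, if_neg (by omega)] at h
  simpa [div_eq_inv_mul] using h.symm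

/-- Pairs `(i, T)` with `i ∉ T` and `#T = k` correspond to pointed sets `(insert i T, i)`
of size `k + 1`. -/
theorem sum_powersetCard_erase_eq {M ι : Type*} [AddCommMonoid M] [DecidableEq ι]
    (u : Finset ι) (k : ℕ) (g : ι → Finset ι → M) :
    ∑ i ∈ u, ∑ T ∈ (u.erase i).powersetCard k, g i T =
      ∑ S ∈ u.powersetCard (k + 1), ∑ i ∈ S, g i (S.erase i) := by
  rw [Finset.sum_sigma', Finset.sum_sigma']
  refine Finset.sum_bij' (fun p _ => ⟨insert p.1 p.2, p.1⟩) (fun q _ => ⟨q.2, q.1.erase q.2⟩)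
    ?_ ?_ ?_ ?_ ?_
  · rintro ⟨i, T⟩ h
    simp only [Finset.mem_sigma, Finset.mem_powersetCard, Finset.subset_erase] at h ⊢
    obtain ⟨hi, ⟨hT, hiT⟩, hc⟩ := h
    exact ⟨⟨Finset.insert_subset hi hT, by rw [Finset.card_insert_of_notMem hiT, hc]⟩,
      Finset.mem_insert_self i T⟩
  · rintro ⟨S, i⟩ h
    simp only [Finset.mem_sigma, Finset.mem_powersetCard] at h ⊢
    obtain ⟨⟨hS, hc⟩, hi⟩ := h
    exact ⟨hS hi, Finset.erase_subset_erase i hS, by rw [Finset.card_erase_of_mem hi, hc]; rfl⟩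
  · rintro ⟨i, T⟩ h
    simp only [Finset.mem_sigma, Finset.mem_powersetCard, Finset.subset_erase] at h
    simp [Finset.erase_insert h.2.1.2]
  · rintro ⟨S, i⟩ h
    simp only [Finset.mem_sigma] at h
    simp [Finset.insert_erase h.2]
  · rintro ⟨i, T⟩ h
    simp only [Finset.mem_sigma, Finset.mem_powersetCard, Finset.subset_erase] at h
    simp [Finset.erase_insert h.2.1.2]

/-- with `f^{(n)}(a_i; …) = ∑_{T ⊆ {1,…,n−2}∖{i}, |T| = ⌊n/2⌋} 1/∏_{t∈T}(ζ_{a_i}−ζ_{a_t})`,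
one has `∑_{i=1}^{n−2} f^{(n)}(a_i; …) ζ_{a_i}^m = 0` for `0 ≤ m ≤ ⌊n/2⌋ − 1`. -/
theorem stmt_1 (F : Type*) [Field F] [CharZero F] (n : ℕ) (hn : 5 ≤ n)
    (ζ : Fin n → F) (hζ : Function.Injective ζ)
    (a : Fin (n - 2) → Fin n) (ha : StrictMono a)
    (m : ℕ) (hm : m < n / 2) :
    ∑ i : Fin (n - 2),
      (∑ T ∈ (Finset.univ.erase i).powersetCard (n / 2),
        (∏ t ∈ T, (ζ (a i) - ζ (a t)))⁻¹) * ζ (a i) ^ m = 0 := by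
  simp_rw [Finset.sum_mul]
  rw [sum_powersetCard_erase_eq Finset.univ (n / 2)
    (fun i T => (∏ t ∈ T, (ζ (a i) - ζ (a t)))⁻¹ * ζ (a i) ^ m)]
  refine Finset.sum_eq_zero fun S hS => ?_
  have hc := (Finset.mem_powersetCard.mp hS).2
  exact sum_inv_prod_sub_mul_pow_eq_zero (hζ.comp ha.injective) S (by omega)
end

section
/- Let q ∈ {1,…,n} and let {a_1, …, a_{n−1}} = {1,…,n}∖{q}. For any ⌊(n−1)/2⌋ pairwise different indices j_1, …, j_{⌊(n−1)/2⌋} in {1,…,n−1}, the vectors f^{(n)}_{A∖{a_{j_m}}} ∈ F^n for m = 1, …, ⌊(n−1)/2⌋, where A = {a_1,…,a_{n−1}}, are linearly independent over F. -/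
/-- The vector `f^{(n)}_S ∈ F^n` associated to an `(n−3)`-simplex with vertex set `S`
(`|S| = n−2`): its `r`-th component is `∑_{T ⊆ S∖{r}, |T| = ⌊n/2⌋} 1/∏_{t∈T}(ζ_r − ζ_t)`
for `r ∈ S`, and `0` for `r ∉ S`. -/
def fvec {F : Type*} [Field F] {n : ℕ} (ζ : Fin n → F) (S : Finset (Fin n)) : Fin n → F :=
  fun r => if r ∈ S then
    ∑ T ∈ (S.erase r).powersetCard (n / 2), (∏ t ∈ T, (ζ r - ζ t))⁻¹
  else 0

open Polynomial in
/-- The coefficients of `∏ (X + y t)`, expressed through the elementary symmetric functions of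
the inverses of the `y t`. -/
lemma coeff_prod_X_add_C_eq_prod_mul_sum_inv {F ι : Type*} [Field F] [DecidableEq ι]
    (U : Finset ι) (y : ι → F) (hy : ∀ t ∈ U, y t ≠ 0) (k : ℕ) :
    (∏ t ∈ U, (X + C (y t))).coeff k =
      (∏ t ∈ U, y t) * ∑ T ∈ U.powersetCard k, (∏ t ∈ T, y t)⁻¹ := by
  rw [Finset.prod_add, finsetSum_coeff, Finset.mul_sum, Finset.powersetCard_eq_filter,
    Finset.sum_filter]
  refine Finset.sum_congr rfl fun T hT => ?_
  rw [Finset.mem_powerset] at hT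
  have hT0 : ∏ t ∈ T, y t ≠ 0 := Finset.prod_ne_zero_iff.2 fun t ht => hy t (hT ht)
  rw [Finset.prod_const, ← map_prod, mul_comm, coeff_C_mul, coeff_X_pow,
    ← Finset.prod_sdiff hT]
  by_cases h : T.card = k
  · simp [h, hT0]
  · simp [h, Ne.symm h]

open Polynomial in
/-- Up to the factor `∏ (ζ r - ζ t)`, which does not depend on `s`, the `r`-th component of
`fvec ζ (A.erase s)` is the value at `ζ r` of a polynomial depending only on `s`. -/
lemma prod_mul_fvec_erase {F : Type*} [Field F] {n : ℕ} (ζ : Fin n → F)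
    (hζ : Function.Injective ζ) (A : Finset (Fin n)) {r s : Fin n} (hr : r ∈ A) (hs : s ∈ A) :
    (∏ t ∈ A.erase r, (ζ r - ζ t)) * fvec ζ (A.erase s) r =
      ((X - C (ζ s)) * hasseDeriv (n / 2 + 1) (∏ t ∈ A.erase s, (X - C (ζ t)))).eval (ζ r) := by
  rcases eq_or_ne r s with rfl | hrs
  · simp [fvec]
  have hrs' : r ∈ A.erase s := Finset.mem_erase.2 ⟨hrs, hr⟩
  have hsr' : s ∈ A.erase r := Finset.mem_erase.2 ⟨hrs.symm, hs⟩
  have htaylor : taylor (ζ r) (∏ t ∈ A.erase s, (X - C (ζ t))) =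
      X * ∏ t ∈ (A.erase s).erase r, (X + C (ζ r - ζ t)) := by
    rw [← Finset.mul_prod_erase _ _ hrs', taylor_mul, ← taylorAlgHom_apply (ζ r) (∏ t ∈ _, _),
      map_prod]
    congr 1
    · simp
    · refine Finset.prod_congr rfl fun t _ => ?_
      simp [add_sub_assoc]
  rw [eval_mul, ← taylor_coeff, htaylor, coeff_X_mul, coeff_prod_X_add_C_eq_prod_mul_sum_inv,
    ← Finset.mul_prod_erase _ _ hsr', Finset.erase_right_comm, fvec, if_pos hrs']
  · simp [mul_assoc]
  · intro t ht
    exact sub_ne_zero.2 fun h => (Finset.mem_erase.1 ht).1 (hζ h).symm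

open Polynomial in
lemma X_sub_C_mul_hasseDeriv_succ {R : Type*} [CommRing R] (a : R) (p : R[X]) (k : ℕ) :
    (X - C a) * hasseDeriv (k + 1) p =
      hasseDeriv (k + 1) ((X - C a) * p) - hasseDeriv k p := by
  ext i
  rcases i with _ | i
  · simp [sub_mul, hasseDeriv_coeff]
  · have hpascal : ((i + k + 1 + 1).choose (k + 1) : R) =
        (i + k + 1).choose k + (i + k + 1).choose (k + 1) := by
      rw [Nat.choose_succ_succ, Nat.cast_add]
    simp only [sub_mul, coeff_sub, hasseDeriv_coeff, coeff_X_mul, coeff_C_mul, ← add_assoc,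
      add_right_comm i 1 k, hpascal]
    ring

open Polynomial in
/-- If `|A| = |J| + k` and `|J| ≥ 2`, a combination over `s ∈ J ⊆ A` of the polynomials
`(X - ζ s) * D_{k+1} ∏_{t ∈ A, t ≠ s} (X - ζ t)`, with `D` the Hasse derivative,
vanishes only trivially. -/
lemma eq_zero_of_sum_mul_hasseDeriv_eq_zero {F ι : Type*} [Field F] [CharZero F] [DecidableEq ι]
    (ζ : ι → F) (hζ : Function.Injective ζ) (A J : Finset ι) (hJA : J ⊆ A) (k : ℕ)
    (hcard : A.card = J.card + k) (hJ : 2 ≤ J.card) (c : ι → F)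
    (h : ∑ s ∈ J, C (c s) *
      ((X - C (ζ s)) * hasseDeriv (k + 1) (∏ t ∈ A.erase s, (X - C (ζ t)))) = 0) :
    ∀ s ∈ J, c s = 0 := by
  set P : ι → F[X] := fun s => ∏ t ∈ A.erase s, (X - C (ζ t)) with hP
  obtain ⟨m, hm⟩ := Nat.exists_eq_add_of_le' hJ
  have hdeg : ∀ s ∈ J, (P s).natDegree = m + (k + 1) := fun s hs => by
    rw [hP, natDegree_finsetProd_X_sub_C_eq_card, Finset.card_erase_of_mem (hJA hs)]
    omega
  have hmonic : ∀ s, (P s).Monic := fun s => monic_prod_X_sub_C _ _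
  have hsum : ∑ s ∈ J, c s = 0 := by
    have h' := congrArg (fun p : F[X] => p.coeff (m + 1)) h
    simp only [finsetSum_coeff, coeff_C_mul, coeff_zero] at h'
    have hterm : ∀ s ∈ J, c s * ((X - C (ζ s)) * hasseDeriv (k + 1) (P s)).coeff (m + 1) =
        c s * ((m + (k + 1)).choose (k + 1) : F) := fun s hs => by
      have h1 : (P s).coeff (m + (k + 1)) = 1 := by
        rw [← hdeg s hs]; exact hmonic s
      have h2 : (P s).coeff (m + 1 + (k + 1)) = 0 :=
        coeff_eq_zero_of_natDegree_lt (by rw [hdeg s hs]; omega)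
      rw [sub_mul, coeff_sub, coeff_X_mul, coeff_C_mul, hasseDeriv_coeff, hasseDeriv_coeff, h1, h2]
      simp
    rw [Finset.sum_congr rfl hterm, ← Finset.sum_mul] at h'
    refine (mul_eq_zero.1 h').resolve_right ?_
    exact_mod_cast (Nat.choose_pos (by omega)).ne'
  have hleibniz : ∀ s ∈ J, (X - C (ζ s)) * hasseDeriv (k + 1) (P s) =
      hasseDeriv (k + 1) (∏ t ∈ A, (X - C (ζ t))) - hasseDeriv k (P s) := fun s hs => by
    rw [← Finset.mul_prod_erase _ _ (hJA hs)]
    exact X_sub_C_mul_hasseDeriv_succ (ζ s) (P s) k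
  set R : F[X] := ∑ s ∈ J, C (c s) * P s with hR
  have hDR : hasseDeriv k R = 0 := by
    rw [Finset.sum_congr rfl fun s hs => by rw [hleibniz s hs, mul_sub],
      Finset.sum_sub_distrib, ← Finset.sum_mul, ← map_sum, hsum, map_zero, zero_mul, zero_sub,
      neg_eq_zero] at h
    rw [hR, map_sum, ← h]
    refine Finset.sum_congr rfl fun s _ => ?_
    rw [← smul_eq_C_mul, map_smul, smul_eq_C_mul]
  have hRcoeff : ∀ i, k ≤ i → R.coeff i = 0 := fun i hi => by
    obtain ⟨l, rfl⟩ := Nat.exists_eq_add_of_le' hi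
    have h' := congrArg (fun p : F[X] => p.coeff l) hDR
    simp only [hasseDeriv_coeff, coeff_zero] at h'
    refine (mul_eq_zero.1 h').resolve_left ?_
    exact_mod_cast (Nat.choose_pos (by omega)).ne'
  have hR0 : R = 0 := by
    refine eq_zero_of_degree_lt_of_eval_finset_eq_zero ((A \ J).map ⟨ζ, hζ⟩) ?_ ?_
    · rw [Finset.card_map, Finset.card_sdiff_of_subset hJA, hcard, Nat.add_sub_cancel_left,
        degree_lt_iff_coeff_zero]
      exact hRcoeff
    · simp only [Finset.mem_map, Finset.mem_sdiff, Function.Embedding.coeFn_mk,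
        forall_exists_index, and_imp]
      rintro _ t htA htJ rfl
      rw [hR, eval_finsetSum]
      refine Finset.sum_eq_zero fun s hs => ?_
      have ht : t ∈ A.erase s := Finset.mem_erase.2 ⟨fun h => htJ (h ▸ hs), htA⟩
      rw [eval_mul, hP, eval_prod, Finset.prod_eq_zero ht (by simp), mul_zero]
  intro s hs
  have heval := congrArg (eval (ζ s)) hR0
  rw [hR, eval_finsetSum, eval_zero, Finset.sum_eq_single_of_mem s hs, eval_mul, eval_C] at heval
  · refine (mul_eq_zero.1 heval).resolve_right ?_
    rw [hP, eval_prod]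
    refine Finset.prod_ne_zero_iff.2 fun t ht => ?_
    simpa [sub_eq_zero] using fun h => (Finset.mem_erase.1 ht).1 (hζ h).symm
  · intro t _ hts
    have hst : s ∈ A.erase t := Finset.mem_erase.2 ⟨hts.symm, hJA hs⟩
    rw [eval_mul, hP, eval_prod, Finset.prod_eq_zero hst (by simp), mul_zero]

open Polynomial in
/-- If `|A| = |J| + ⌊n/2⌋` and `|J| ≥ 2`, the vectors `fvec ζ (A.erase s)`, `s ∈ J ⊆ A`, satisfy
no nontrivial linear relation. -/
lemma eq_zero_of_sum_mul_fvec_eq_zero {F : Type*} [Field F] [CharZero F] {n : ℕ} (ζ : Fin n → F)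
    (hζ : Function.Injective ζ) (A J : Finset (Fin n)) (hJA : J ⊆ A)
    (hcard : A.card = J.card + n / 2) (hJ : 2 ≤ J.card) (c : Fin n → F)
    (h : ∀ r ∈ A, ∑ s ∈ J, c s * fvec ζ (A.erase s) r = 0) :
    ∀ s ∈ J, c s = 0 := by
  refine eq_zero_of_sum_mul_hasseDeriv_eq_zero ζ hζ A J hJA (n / 2) hcard hJ c ?_
  refine eq_zero_of_natDegree_lt_card_of_eval_eq_zero' _ (A.map ⟨ζ, hζ⟩) ?_ ?_
  · simp only [Finset.mem_map, Function.Embedding.coeFn_mk, forall_exists_index, and_imp]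
    rintro _ r hr rfl
    rw [eval_finsetSum]
    calc _ = ∑ s ∈ J, (∏ t ∈ A.erase r, (ζ r - ζ t)) * (c s * fvec ζ (A.erase s) r) := by
          refine Finset.sum_congr rfl fun s hs => ?_
          rw [eval_C_mul, ← prod_mul_fvec_erase ζ hζ A hr (hJA hs), mul_left_comm]
      _ = 0 := by rw [← Finset.mul_sum, h r hr, mul_zero]
  · rw [Finset.card_map]
    refine lt_of_le_of_lt (natDegree_sum_le_of_forall_le J _ (n := A.card - 1) ?_) (by omega)
    intro s hs
    refine (natDegree_C_mul_le _ _).trans (natDegree_mul_le.trans ?_)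
    rw [natDegree_X_sub_C]
    have := natDegree_hasseDeriv_le (∏ t ∈ A.erase s, (X - C (ζ t))) (n / 2 + 1)
    rw [natDegree_finsetProd_X_sub_C_eq_card, Finset.card_erase_of_mem (hJA hs)] at this
    omega

/-- for `A = {1,…,n}∖{q}` and any `⌊(n−1)/2⌋` pairwise different indices
`j_1,…,j_{⌊(n−1)/2⌋}` into an enumeration `a` of `A`, the vectors `f^{(n)}_{A∖{a_{j_m}}}`
are linearly independent. -/
theorem stmt_2 (F : Type*) [Field F] [CharZero F] (n : ℕ) (hn : 5 ≤ n)
    (ζ : Fin n → F) (hζ : Function.Injective ζ) (q : Fin n)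
    (a : Fin (n - 1) → Fin n) (hainj : Function.Injective a)
    (haq : ∀ i, a i ≠ q)
    (j : Fin ((n - 1) / 2) → Fin (n - 1)) (hj : Function.Injective j) :
    LinearIndependent F
      (fun m : Fin ((n - 1) / 2) =>
        fvec ζ ((Finset.univ.erase q).erase (a (j m)))) := by
  have hinj : Function.Injective fun m => a (j m) := hainj.comp hj
  rw [Fintype.linearIndependent_iff]
  intro g hg m
  have hc : ∀ m, Function.extend (fun m => a (j m)) g 0 (a (j m)) = g m :=
    fun m => hinj.extend_apply g 0 m
  rw [← hc m]
  refine eq_zero_of_sum_mul_fvec_eq_zero ζ hζ (Finset.univ.erase q)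
    (Finset.univ.map ⟨fun m => a (j m), hinj⟩) ?_ ?_ ?_ _ ?_ _ ?_
  · intro t
    simp only [Finset.mem_map, Finset.mem_univ, true_and, Function.Embedding.coeFn_mk,
      Finset.mem_erase, and_true, forall_exists_index]
    rintro m rfl
    exact haq _
  · rw [Finset.card_map, Finset.card_erase_of_mem (Finset.mem_univ q), Finset.card_fin,
      Finset.card_fin]
    omega
  · rw [Finset.card_map, Finset.card_fin]
    omega
  · intro r _
    rw [Finset.sum_map]
    simpa [hc] using congrFun hg r
  · simp
end

section
/- Assume n is odd. Let q ∈ {1,…,n} and let A = {a_1, …, a_{n−1}} = {1,…,n}∖{q} with a_1 < a_2 < … < a_{n−1}. Then for every i ∈ {1, …, (n−1)/2}: f^{(n)}_{A∖{a_{n−2i}}} = ∑_{j=1}^{(n−1)/2} c_{ij} · f^{(n)}_{A∖{a_{n+1−2j}}}, where c_{ij} = ∏_{j'=1, j'≠j}^{(n−1)/2} (ζ_{a_{n−2i}} − ζ_{a_{n+1−2j'}}) / ∏_{j'=1, j'≠j}^{(n−1)/2} (ζ_{a_{n+1−2j}} − ζ_{a_{n+1−2j'}}). (Equivalently, the matrix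 P_{a_2 a_4 ⋯ a_{n−1}, a_1 a_3 ⋯ a_{n−2}} with (i,j)-entry c_{ij} maps the column of vectors f^{(n)}_{A∖{a_{n+1−2j}}}, j = 1,…,(n−1)/2, to the column of vectors f^{(n)}_{A∖{a_{n−2i}}}, i = 1,…,(n−1)/2.) -/
/-- Adding one element `x` to a finite set: the elementary symmetric sum of the inverses
satisfies the Pascal-type recursion. -/
theorem sum_powersetCard_succ_inv_prod {ι F : Type*} [DecidableEq ι] [Field F] (w : ι → F)
    {B : Finset ι} {x : ι} (hx : x ∈ B) (k : ℕ) :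
    ∑ T ∈ B.powersetCard (k + 1), (∏ t ∈ T, w t)⁻¹ =
      ∑ T ∈ (B.erase x).powersetCard (k + 1), (∏ t ∈ T, w t)⁻¹ +
        (w x)⁻¹ * ∑ T ∈ (B.erase x).powersetCard k, (∏ t ∈ T, w t)⁻¹ := by
  have hmem : ∀ {l : ℕ} {T : Finset ι}, T ∈ (B.erase x).powersetCard l → x ∉ T := by
    intro l T hT hxT
    exact Finset.notMem_erase x B ((Finset.mem_powersetCard.1 hT).1 hxT)
  conv_lhs => rw [← Finset.insert_erase hx]
  rw [Finset.powersetCard_succ_insert (Finset.notMem_erase x B), Finset.sum_union,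
    Finset.sum_image, Finset.mul_sum]
  · congr 1
    refine Finset.sum_congr rfl fun T hT => ?_
    rw [Finset.prod_insert (hmem hT), mul_inv]
  · intro T hT U hU h
    rw [← Finset.erase_insert (hmem hT), ← Finset.erase_insert (hmem hU), h]
  · rw [Finset.disjoint_left]
    intro T hT hT'
    obtain ⟨U, -, rfl⟩ := Finset.mem_image.1 hT'
    exact hmem hT (Finset.mem_insert_self x U)

/-- The elementary symmetric sum of degree `|B| - d` of the inverses `(w t)⁻¹`, `t ∈ B ∖ {x}`, is
a polynomial in `w x` of degree at most `d` without constant term. -/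
theorem exists_polynomial_eval_eq_sum_inv_prod {ι F : Type*} [DecidableEq ι] [Field F]
    (w : ι → F) (B : Finset ι) (hw : ∀ x ∈ B, w x ≠ 0) (d k : ℕ) (hk : k + d = B.card) :
    ∃ Q : Polynomial F, Q.natDegree ≤ d ∧ Q.eval 0 = 0 ∧
      ∀ x ∈ B, ∑ T ∈ (B.erase x).powersetCard k, (∏ t ∈ T, w t)⁻¹ = Q.eval (w x) := by
  induction d generalizing k with
  | zero =>
    refine ⟨0, by simp, by simp, fun x hx => ?_⟩
    rw [Finset.powersetCard_eq_empty.2]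
    · simp
    · have := Finset.card_erase_lt_of_mem hx
      omega
  | succ d ih =>
    obtain ⟨Q, hdeg, -, hQ⟩ := ih (k + 1) (by omega)
    refine ⟨Polynomial.X *
      (Polynomial.C (∑ T ∈ B.powersetCard (k + 1), (∏ t ∈ T, w t)⁻¹) - Q), ?_, by simp, ?_⟩
    · refine Polynomial.natDegree_mul_le.trans ?_
      have h₁ := Polynomial.natDegree_X_le (R := F)
      have h₂ := Polynomial.natDegree_sub_le_of_le (Polynomial.natDegree_C
        (∑ T ∈ B.powersetCard (k + 1), (∏ t ∈ T, w t)⁻¹)).le hdeg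
      simp only [Nat.zero_le, max_eq_right] at h₂
      omega
    · intro x hx
      have := hw x hx
      simp only [Polynomial.eval_mul, Polynomial.eval_X, Polynomial.eval_sub,
        Polynomial.eval_C, ← hQ x hx, sum_powersetCard_succ_inv_prod w hx k]
      field_simp
      ring

/-- Each component of `fvec ζ (A ∖ {x})`, with `|A| = 2m` and `n = 2m + 1`, is a polynomial of
degree less than `m` in `ζ x`. -/
theorem exists_polynomial_eval_eq_fvec {F : Type*} [Field F] {m n : ℕ} (hm : 0 < m)
    (hn : n / 2 = m) (ζ : Fin n → F) (hζ : Function.Injective ζ) (A : Finset (Fin n))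
    (hA : A.card = 2 * m) (r : Fin n) :
    ∃ P : Polynomial F, P.natDegree < m ∧ ∀ x ∈ A, fvec ζ (A.erase x) r = P.eval (ζ x) := by
  by_cases hr : r ∈ A
  · obtain ⟨Q, hdeg, hzero, hQ⟩ := exists_polynomial_eval_eq_sum_inv_prod (fun t => ζ r - ζ t)
      (A.erase r) (fun x hx => sub_ne_zero.2 fun h => Finset.ne_of_mem_erase hx (hζ h).symm)
      (m - 1) m (by rw [Finset.card_erase_of_mem hr]; omega)
    refine ⟨Q.comp (Polynomial.C (ζ r) - Polynomial.X), ?_, fun x hx => ?_⟩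
    · have h₁ := Polynomial.natDegree_comp_le (p := Q) (q := Polynomial.C (ζ r) - Polynomial.X)
      have h₂ : (Polynomial.C (ζ r) - Polynomial.X).natDegree ≤ 1 :=
        (Polynomial.natDegree_sub_le _ _).trans (by simp)
      have h₃ := Nat.mul_le_mul hdeg h₂
      omega
    · by_cases hxr : r = x
      · simp [fvec, hxr.symm, hzero]
      · have := hQ x (Finset.mem_erase.2 ⟨Ne.symm hxr, hx⟩)
        simp only [fvec, Finset.mem_erase, ne_eq, hxr, not_false_eq_true, hr, and_self, if_true,
          Polynomial.eval_comp, Polynomial.eval_sub, Polynomial.eval_C, Polynomial.eval_X]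
        rw [← this, hn, Finset.erase_right_comm]
  · exact ⟨0, by simpa using hm, fun x _ => by simp [fvec, hr]⟩

/-- Lagrange interpolation, evaluated at a point. -/
theorem Polynomial.eval_eq_sum_lagrange {ι F : Type*} [DecidableEq ι] [Field F] {s : Finset ι}
    {v : ι → F} (hv : Set.InjOn v s) {P : Polynomial F} (hP : P.degree < s.card) (z : F) :
    P.eval z = ∑ j ∈ s, (∏ k ∈ s.erase j, (z - v k)) / (∏ k ∈ s.erase j, (v j - v k)) *
      P.eval (v j) := by
  conv_lhs => rw [Lagrange.eq_interpolate hv hP]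
  rw [Lagrange.interpolate_apply, Polynomial.eval_finsetSum]
  refine Finset.sum_congr rfl fun j _ => ?_
  rw [Polynomial.eval_mul, Polynomial.eval_C, mul_comm, Lagrange.basis, Polynomial.eval_prod,
    ← Finset.prod_div_distrib]
  congr 1
  refine Finset.prod_congr rfl fun k _ => ?_
  simp [Lagrange.basisDivisor, div_eq_inv_mul]

/-- odd `n`: with `a_1 < ⋯ < a_{n−1}` enumerating `A = {1,…,n}∖{q}`,
for every `i ∈ {1,…,(n−1)/2}`:
`f^{(n)}_{A∖{a_{n−2i}}} = ∑_{j=1}^{(n−1)/2} c_{ij} · f^{(n)}_{A∖{a_{n+1−2j}}}` where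
`c_{ij} = ∏_{j'≠j}(ζ_{a_{n−2i}} − ζ_{a_{n+1−2j'}}) / ∏_{j'≠j}(ζ_{a_{n+1−2j}} − ζ_{a_{n+1−2j'}})`. -/
theorem stmt_4 (F : Type*) [Field F] [CharZero F] (n : ℕ) (hn : 5 ≤ n) (hodd : Odd n)
    (ζ : Fin n → F) (hζ : Function.Injective ζ) (q : Fin n)
    (a : ℕ → Fin n) (hmono : StrictMonoOn a (Set.Icc 1 (n - 1)))
    (himg : (Finset.Icc 1 (n - 1)).image a = Finset.univ.erase q) :
    ∀ i ∈ Finset.Icc 1 ((n - 1) / 2),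
      fvec ζ ((Finset.univ.erase q).erase (a (n - 2 * i))) =
      ∑ j ∈ Finset.Icc 1 ((n - 1) / 2),
        ((∏ j' ∈ (Finset.Icc 1 ((n - 1) / 2)).erase j,
            (ζ (a (n - 2 * i)) - ζ (a (n + 1 - 2 * j')))) /
         (∏ j' ∈ (Finset.Icc 1 ((n - 1) / 2)).erase j,
            (ζ (a (n + 1 - 2 * j)) - ζ (a (n + 1 - 2 * j'))))) •
        fvec ζ ((Finset.univ.erase q).erase (a (n + 1 - 2 * j))) := by
  intro i hi
  obtain ⟨m, rfl⟩ := hodd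
  have hm : (2 * m + 1 - 1) / 2 = m := by omega
  rw [hm] at hi ⊢
  have hmem : ∀ k, 1 ≤ k → k ≤ 2 * m → a k ∈ Finset.univ.erase q := fun k h₁ h₂ =>
    himg ▸ Finset.mem_image_of_mem a (Finset.mem_Icc.2 ⟨h₁, by omega⟩)
  funext r
  obtain ⟨P, hdeg, hP⟩ := exists_polynomial_eval_eq_fvec (m := m) (by omega) (by omega) ζ hζ
    (Finset.univ.erase q) (by simp) r
  rw [Finset.mem_Icc] at hi
  have hinj : Set.InjOn (fun j => ζ (a (2 * m + 1 + 1 - 2 * j))) (Finset.Icc 1 m) := by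
    intro j hj k hk h
    rw [Finset.mem_coe, Finset.mem_Icc] at hj hk
    have := hmono.injOn (Set.mem_Icc.2 ⟨by omega, by omega⟩)
      (Set.mem_Icc.2 ⟨by omega, by omega⟩) (hζ h)
    omega
  have hcard : P.degree < (Finset.Icc 1 m).card := by
    rw [Nat.card_Icc, Nat.add_sub_cancel]
    exact Polynomial.degree_le_natDegree.trans_lt (by exact_mod_cast hdeg)
  rw [hP _ (hmem _ (by omega) (by omega)), Polynomial.eval_eq_sum_lagrange hinj hcard,
    Finset.sum_apply]
  refine Finset.sum_congr rfl fun j hj => ?_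
  rw [Finset.mem_Icc] at hj
  rw [Pi.smul_apply, smul_eq_mul, hP _ (hmem _ (by omega) (by omega))]
end

section
/- Assume n is even. Let q ∈ {1,…,n} and let A = {a_1, …, a_{n−1}} = {1,…,n}∖{q} with a_1 < a_2 < … < a_{n−1}. Then: (i) for every i ∈ {2, …, n/2}: f^{(n)}_{A∖{a_{n+2−2i}}} = ∑_{j=1}^{n/2−1} c_j(a_{n+2−2i}) · f^{(n)}_{A∖{a_{n−1−2j}}}, and (ii) f^{(n)}_{A∖{a_{n−1}}} = ∑_{j=1}^{n/2−1} c_j(a_{n−1}) · f^{(n)}_{A∖{a_{n−1−2j}}}, where for an index b the coefficient is c_j(b) = ∏_{j'=1, j'≠j}^{n/2−1} (ζ_{a_b'} − ζ_{a_{n−1−2j'}}) / ∏_{j'=1, j'≠j}^{n/2−1} (ζ_{a_{n−1−2j}} − ζ_{a_{n−1−2j'}}) with ζ_{a_b'} denoting ζ_b for the displayed element b (i.e. b = a_{n+2−2i} in case (i) and b = a_{n−1} in case (ii)). -/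
open Polynomial in
/-- The elementary symmetric sums of degree `k` of `y` over `B ∖ {b}` are the values at `y b` of a
single polynomial of degree at most `k`. -/
lemma exists_polynomial_eval_eq_sum_powersetCard_erase {F ι : Type*} [Field F] [DecidableEq ι]
    (B : Finset ι) (y : ι → F) (k : ℕ) :
    ∃ Q : F[X], Q.natDegree ≤ k ∧
      ∀ b ∈ B, Q.eval (y b) = ∑ T ∈ (B.erase b).powersetCard k, ∏ t ∈ T, y t := by
  induction k with
  | zero => exact ⟨1, by simp, by simp⟩
  | succ k ih =>
    obtain ⟨Q, hdeg, hQ⟩ := ih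
    refine ⟨C (∑ T ∈ B.powersetCard (k + 1), ∏ t ∈ T, y t) - X * Q, ?_, fun b hb => ?_⟩
    · refine (natDegree_sub_le _ _).trans (max_le ((natDegree_C _).trans_le (Nat.zero_le _)) ?_)
      refine natDegree_mul_le.trans ?_
      rw [natDegree_X]
      omega
    · have hsplit : ∑ T ∈ B.powersetCard (k + 1), ∏ t ∈ T, y t =
          ∑ T ∈ (B.erase b).powersetCard (k + 1), ∏ t ∈ T, y t +
            y b * ∑ T ∈ (B.erase b).powersetCard k, ∏ t ∈ T, y t := by
        have hmem : ∀ T ∈ (B.erase b).powersetCard k, b ∉ T := fun T hT hbT =>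
          Finset.notMem_erase b B ((Finset.mem_powersetCard.mp hT).1 hbT)
        conv_lhs => rw [← Finset.insert_erase hb]
        rw [Finset.powersetCard_succ_insert (Finset.notMem_erase b B), Finset.sum_union,
          Finset.sum_image, Finset.mul_sum]
        · congr 1
          exact Finset.sum_congr rfl fun T hT => Finset.prod_insert (hmem T hT)
        · intro T hT U hU h
          rw [← Finset.erase_insert (hmem T hT), ← Finset.erase_insert (hmem U hU)]
          exact congrArg (fun s => Finset.erase s b) h
        · rw [Finset.disjoint_left]
          rintro T hT hT'
          obtain ⟨U, -, rfl⟩ := Finset.mem_image.mp hT'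
          exact Finset.notMem_erase b B
            ((Finset.mem_powersetCard.mp hT).1 (Finset.mem_insert_self b U))
      simp only [eval_sub, eval_C, eval_mul, eval_X, hQ b hb, hsplit]
      ring

/-- An elementary symmetric sum of reciprocals, expressed through the complementary one. -/
lemma sum_powersetCard_prod_inv {F ι : Type*} [Field F] [DecidableEq ι] (B : Finset ι)
    (y : ι → F) (hy : ∀ t ∈ B, y t ≠ 0) {k l : ℕ} (hkl : k + l = B.card) :
    ∑ T ∈ B.powersetCard k, (∏ t ∈ T, y t)⁻¹ =
      (∏ t ∈ B, y t)⁻¹ * ∑ T ∈ B.powersetCard l, ∏ t ∈ T, y t := by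
  rw [Finset.mul_sum]
  refine Finset.sum_nbij' (B \ ·) (B \ ·) ?_ ?_ ?_ ?_ ?_
  · intro T hT
    obtain ⟨hTB, hT⟩ := Finset.mem_powersetCard.mp hT
    refine Finset.mem_powersetCard.mpr ⟨Finset.sdiff_subset, ?_⟩
    rw [Finset.card_sdiff_of_subset hTB]
    omega
  · intro T hT
    obtain ⟨hTB, hT⟩ := Finset.mem_powersetCard.mp hT
    refine Finset.mem_powersetCard.mpr ⟨Finset.sdiff_subset, ?_⟩
    rw [Finset.card_sdiff_of_subset hTB]
    omega
  · exact fun T hT => Finset.sdiff_sdiff_eq_self (Finset.mem_powersetCard.mp hT).1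
  · exact fun T hT => Finset.sdiff_sdiff_eq_self (Finset.mem_powersetCard.mp hT).1
  · intro T hT
    have hTB := (Finset.mem_powersetCard.mp hT).1
    have hne : ∏ t ∈ B \ T, y t ≠ 0 :=
      Finset.prod_ne_zero_iff.mpr fun t ht => hy t (Finset.sdiff_subset ht)
    rw [← Finset.prod_sdiff hTB, mul_inv, mul_comm (∏ t ∈ B \ T, y t)⁻¹, mul_assoc,
      inv_mul_cancel₀ hne, mul_one]

open Polynomial in
/-- For a fixed component `r`, the values `f_{A ∖ {b}}(r)`, `b ∈ A`, are the values at `ζ b` of a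
polynomial of degree less than `n / 2 - 1`. -/
lemma exists_polynomial_eval_eq_fvec_erase {F : Type*} [Field F] {n : ℕ} (hn : 6 ≤ n)
    (heven : Even n) (ζ : Fin n → F) (hζ : Function.Injective ζ) (A : Finset (Fin n))
    (hA : A.card = n - 1) (r : Fin n) :
    ∃ P : F[X], P.degree < ((n / 2 - 1 : ℕ) : WithBot ℕ) ∧
      ∀ b ∈ A, P.eval (ζ b) = fvec ζ (A.erase b) r := by
  by_cases hr : r ∈ A
  swap
  · refine ⟨0, by simp, fun b _ => ?_⟩
    simp [fvec, hr]
  set y : Fin n → F := fun t => ζ r - ζ t with hy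
  have hlin : (C (ζ r) - X : F[X]).natDegree ≤ 1 :=
    (natDegree_sub_le _ _).trans (by simp)
  obtain ⟨Q, hdeg, hQ⟩ :=
    exists_polynomial_eval_eq_sum_powersetCard_erase (A.erase r) y (n / 2 - 3)
  have hyne : ∀ t ∈ A.erase r, y t ≠ 0 := fun t ht =>
    sub_ne_zero.mpr fun h => Finset.ne_of_mem_erase ht (hζ h).symm
  refine ⟨C (∏ t ∈ A.erase r, y t)⁻¹ * ((C (ζ r) - X) * Q.comp (C (ζ r) - X)), ?_,
    fun b hb => ?_⟩
  · refine lt_of_le_of_lt (degree_le_of_natDegree_le (n := n / 2 - 2) ?_)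
      (by exact_mod_cast (by omega : n / 2 - 2 < n / 2 - 1))
    refine (natDegree_C_mul_le _ _).trans (natDegree_mul_le.trans ?_)
    have hcomp : (Q.comp (C (ζ r) - X)).natDegree ≤ (n / 2 - 3) * 1 :=
      natDegree_comp_le.trans (Nat.mul_le_mul hdeg hlin)
    omega
  · by_cases hbr : b = r
    · subst hbr
      simp [fvec]
    · have hbB : b ∈ A.erase r := Finset.mem_erase.mpr ⟨hbr, hb⟩
      have hcard : n / 2 + (n / 2 - 3) = ((A.erase r).erase b).card := by
        rw [Finset.card_erase_of_mem hbB, Finset.card_erase_of_mem hr, hA]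
        obtain ⟨m, rfl⟩ := heven
        omega
      have hrb : r ∈ A.erase b := Finset.mem_erase.mpr ⟨Ne.symm hbr, hr⟩
      have hsum := sum_powersetCard_prod_inv ((A.erase r).erase b) y
        (fun t ht => hyne t (Finset.mem_of_mem_erase ht)) hcard
      have hyb := hyne b hbB
      have hQb := hQ b hbB
      simp only [hy] at hsum hQb hyb
      rw [fvec, if_pos hrb, Finset.erase_right_comm, hsum, ← hQb,
        ← Finset.mul_prod_erase _ _ hbB]
      simp only [eval_mul, eval_C, eval_sub, eval_X, eval_comp, mul_inv, hy]
      field_simp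

open Polynomial in
/-- Lagrange interpolation with the basis polynomials written out as quotients of products. -/
lemma eval_eq_sum_prod_div_prod_mul_eval {F ι : Type*} [Field F] [DecidableEq ι] (s : Finset ι)
    (v : ι → F) (hv : Set.InjOn v s) (P : F[X]) (hP : P.degree < s.card) (x : F) :
    P.eval x = ∑ j ∈ s,
      ((∏ k ∈ s.erase j, (x - v k)) / ∏ k ∈ s.erase j, (v j - v k)) * P.eval (v j) := by
  conv_lhs => rw [Lagrange.eq_interpolate hv hP]
  rw [Lagrange.interpolate_apply, eval_finsetSum]
  refine Finset.sum_congr rfl fun j _ => ?_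
  simp only [Lagrange.basis, Lagrange.basisDivisor, eval_mul, eval_C, eval_prod, eval_sub, eval_X,
    Finset.prod_mul_distrib, Finset.prod_inv_distrib]
  ring

/-- Any `f_{A ∖ {b}}` is the Lagrange interpolation of the vectors `f_{A ∖ {v j}}` over
`n / 2 - 1` distinct nodes `v j`. -/
lemma fvec_erase_eq_sum {F ι : Type*} [Field F] [DecidableEq ι] {n : ℕ} (hn : 6 ≤ n)
    (heven : Even n) (ζ : Fin n → F) (hζ : Function.Injective ζ) (A : Finset (Fin n))
    (hA : A.card = n - 1) (s : Finset ι) (hs : s.card = n / 2 - 1) (v : ι → Fin n)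
    (hv : Set.InjOn v s) (hvA : ∀ j ∈ s, v j ∈ A) {b : Fin n} (hb : b ∈ A) :
    fvec ζ (A.erase b) = ∑ j ∈ s,
      ((∏ k ∈ s.erase j, (ζ b - ζ (v k))) / ∏ k ∈ s.erase j, (ζ (v j) - ζ (v k))) •
        fvec ζ (A.erase (v j)) := by
  ext r
  obtain ⟨P, hdeg, hP⟩ := exists_polynomial_eval_eq_fvec_erase hn heven ζ hζ A hA r
  rw [← hP b hb, eval_eq_sum_prod_div_prod_mul_eval s (ζ ∘ v) (hζ.comp_injOn hv) P (hs ▸ hdeg),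
    Finset.sum_apply]
  refine Finset.sum_congr rfl fun j hj => ?_
  rw [Pi.smul_apply, smul_eq_mul, ← hP _ (hvA j hj)]
  rfl

/-- even `n`: with `a_1 < ⋯ < a_{n−1}` enumerating `A = {1,…,n}∖{q}`:
(i) for every `i ∈ {2,…,n/2}`,
`f^{(n)}_{A∖{a_{n+2−2i}}} = ∑_{j=1}^{n/2−1} c_j(a_{n+2−2i}) · f^{(n)}_{A∖{a_{n−1−2j}}}`, and
(ii) `f^{(n)}_{A∖{a_{n−1}}} = ∑_{j=1}^{n/2−1} c_j(a_{n−1}) · f^{(n)}_{A∖{a_{n−1−2j}}}`, where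
`c_j(b) = ∏_{j'≠j}(ζ_b − ζ_{a_{n−1−2j'}}) / ∏_{j'≠j}(ζ_{a_{n−1−2j}} − ζ_{a_{n−1−2j'}})`. -/
theorem stmt_5 (F : Type*) [Field F] [CharZero F] (n : ℕ) (hn : 6 ≤ n) (heven : Even n)
    (ζ : Fin n → F) (hζ : Function.Injective ζ) (q : Fin n)
    (a : ℕ → Fin n) (hmono : StrictMonoOn a (Set.Icc 1 (n - 1)))
    (himg : (Finset.Icc 1 (n - 1)).image a = Finset.univ.erase q) :
    (∀ i ∈ Finset.Icc 2 (n / 2),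
      fvec ζ ((Finset.univ.erase q).erase (a (n + 2 - 2 * i))) =
      ∑ j ∈ Finset.Icc 1 (n / 2 - 1),
        ((∏ j' ∈ (Finset.Icc 1 (n / 2 - 1)).erase j,
            (ζ (a (n + 2 - 2 * i)) - ζ (a (n - 1 - 2 * j')))) /
         (∏ j' ∈ (Finset.Icc 1 (n / 2 - 1)).erase j,
            (ζ (a (n - 1 - 2 * j)) - ζ (a (n - 1 - 2 * j'))))) •
        fvec ζ ((Finset.univ.erase q).erase (a (n - 1 - 2 * j))))
    ∧
    (fvec ζ ((Finset.univ.erase q).erase (a (n - 1))) =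
      ∑ j ∈ Finset.Icc 1 (n / 2 - 1),
        ((∏ j' ∈ (Finset.Icc 1 (n / 2 - 1)).erase j,
            (ζ (a (n - 1)) - ζ (a (n - 1 - 2 * j')))) /
         (∏ j' ∈ (Finset.Icc 1 (n / 2 - 1)).erase j,
            (ζ (a (n - 1 - 2 * j)) - ζ (a (n - 1 - 2 * j'))))) •
        fvec ζ ((Finset.univ.erase q).erase (a (n - 1 - 2 * j)))) := by
  have hA : (Finset.univ.erase q).card = n - 1 := by
    rw [Finset.card_erase_of_mem (Finset.mem_univ q), Finset.card_univ, Fintype.card_fin]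
  have hmem : ∀ k, 1 ≤ k → k ≤ n - 1 → a k ∈ Finset.univ.erase q := fun k h1 h2 =>
    himg ▸ Finset.mem_image_of_mem a (Finset.mem_Icc.mpr ⟨h1, h2⟩)
  have hv : Set.InjOn (fun j => a (n - 1 - 2 * j)) (Finset.Icc 1 (n / 2 - 1) : Finset ℕ) := by
    intro j hj k hk h
    simp only [Finset.coe_Icc, Set.mem_Icc] at hj hk
    have := hmono.injOn (Set.mem_Icc.mpr ⟨by omega, by omega⟩)
      (Set.mem_Icc.mpr ⟨by omega, by omega⟩) h
    omega
  have hvA : ∀ j ∈ Finset.Icc 1 (n / 2 - 1), a (n - 1 - 2 * j) ∈ Finset.univ.erase q := by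
    intro j hj
    rw [Finset.mem_Icc] at hj
    exact hmem _ (by omega) (by omega)
  refine ⟨fun i hi => ?_, ?_⟩
  · rw [Finset.mem_Icc] at hi
    exact fvec_erase_eq_sum hn heven ζ hζ _ hA _ (by simp) _ hv hvA
      (hmem _ (by omega) (by omega))
  · exact fvec_erase_eq_sum hn heven ζ hζ _ hA _ (by simp) _ hv hvA
      (hmem _ (by omega) le_rfl)
end

section
/- The following identity of matrix products over F holds (the hexagon equation for the constructed matrices): M_1 · M_2 · M_3 = N_1 · N_2 · N_3, where M_1 is the 6×5 matrix with rows (1,0,0,0,0), (0,1,0,0,0), (0,0,1,0,0), (0,0,0,(ζ_3−ζ_6)/(ζ_3−ζ_5),(ζ_6−ζ_5)/(ζ_3−ζ_5)), (0,0,0,(ζ_3−ζ_4)/(ζ_3−ζ_5),(ζ_4−ζ_5)/(ζ_3−ζ_5)), (0,0,0,(ζ_3−ζ_2)/(ζ_3−ζ_5),(ζ_2−ζ_5)/(ζ_3−ζ_5)); M_2 is the 5×4 matrix with rows ((ζ_3−ζ_4)/(ζ_3−ζ_6),(ζ_4−ζ_6)/(ζ_3−ζ_6),0,0), ((ζ_3−ζ_2)/(ζ_3−ζ_6),(ζ_2−ζ_6)/(ζ_3−ζ_6),0,0),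 (0,0,1,0), ((ζ_3−ζ_1)/(ζ_3−ζ_6),(ζ_1−ζ_6)/(ζ_3−ζ_6),0,0), (0,0,0,1); M_3 is the 4×3 matrix with rows (1,0,0), (0,(ζ_4−ζ_5)/(ζ_4−ζ_6),(ζ_5−ζ_6)/(ζ_4−ζ_6)), (0,(ζ_4−ζ_2)/(ζ_4−ζ_6),(ζ_2−ζ_6)/(ζ_4−ζ_6)), (0,(ζ_4−ζ_1)/(ζ_4−ζ_6),(ζ_1−ζ_6)/(ζ_4−ζ_6)); N_1 is the 6×5 matrix with rows (1,0,0,0,0), (0,(ζ_4−ζ_5)/(ζ_4−ζ_6),(ζ_5−ζ_6)/(ζ_4−ζ_6),0,0), (0,(ζ_4−ζ_3)/(ζ_4−ζ_6),(ζ_3−ζ_6)/(ζ_4−ζ_6),0,0), (0,0,0,1,0), (0,0,0,0,1), (0,(ζ_4−ζ_1)/(ζ_4−ζ_6),(ζ_1−ζ_6)/(ζ_4−ζ_6),0,0); N_2 is the 5×4 matrix with rows ((ζ_3−ζ_5)/(ζ_3−ζ_6),(ζ_5−ζ_6)/(ζ_3−ζ_6),0,0), (0,0,1,0), ((ζ_3−ζ_2)/(ζ_3−ζ_6),(ζ_2−ζ_6)/(ζ_3−ζ_6),0,0),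 (0,0,0,1), ((ζ_3−ζ_1)/(ζ_3−ζ_6),(ζ_1−ζ_6)/(ζ_3−ζ_6),0,0); and N_3 is the 4×3 matrix with rows ((ζ_3−ζ_4)/(ζ_3−ζ_5),(ζ_4−ζ_5)/(ζ_3−ζ_5),0), (0,0,1), ((ζ_3−ζ_2)/(ζ_3−ζ_5),(ζ_2−ζ_5)/(ζ_3−ζ_5),0), ((ζ_3−ζ_1)/(ζ_3−ζ_5),(ζ_1−ζ_5)/(ζ_3−ζ_5),0). -/
/-- the hexagon equation `M₁ · M₂ · M₃ = N₁ · N₂ · N₃` for the constructed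
(extended) matrices. -/
theorem stmt_9 (F : Type*) [Field F] (ζ1 ζ2 ζ3 ζ4 ζ5 ζ6 : F)
    (h12 : ζ1 ≠ ζ2) (h13 : ζ1 ≠ ζ3) (h14 : ζ1 ≠ ζ4) (h15 : ζ1 ≠ ζ5) (h16 : ζ1 ≠ ζ6)
    (h23 : ζ2 ≠ ζ3) (h24 : ζ2 ≠ ζ4) (h25 : ζ2 ≠ ζ5) (h26 : ζ2 ≠ ζ6)
    (h34 : ζ3 ≠ ζ4) (h35 : ζ3 ≠ ζ5) (h36 : ζ3 ≠ ζ6)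
    (h45 : ζ4 ≠ ζ5) (h46 : ζ4 ≠ ζ6) (h56 : ζ5 ≠ ζ6) :
    (!![1, 0, 0, 0, 0;
        0, 1, 0, 0, 0;
        0, 0, 1, 0, 0;
        0, 0, 0, (ζ3 - ζ6) / (ζ3 - ζ5), (ζ6 - ζ5) / (ζ3 - ζ5);
        0, 0, 0, (ζ3 - ζ4) / (ζ3 - ζ5), (ζ4 - ζ5) / (ζ3 - ζ5);
        0, 0, 0, (ζ3 - ζ2) / (ζ3 - ζ5), (ζ2 - ζ5) / (ζ3 - ζ5)] : Matrix (Fin 6) (Fin 5) F) *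
    (!![(ζ3 - ζ4) / (ζ3 - ζ6), (ζ4 - ζ6) / (ζ3 - ζ6), 0, 0;
        (ζ3 - ζ2) / (ζ3 - ζ6), (ζ2 - ζ6) / (ζ3 - ζ6), 0, 0;
        0, 0, 1, 0;
        (ζ3 - ζ1) / (ζ3 - ζ6), (ζ1 - ζ6) / (ζ3 - ζ6), 0, 0;
        0, 0, 0, 1] : Matrix (Fin 5) (Fin 4) F) *
    (!![1, 0, 0;
        0, (ζ4 - ζ5) / (ζ4 - ζ6), (ζ5 - ζ6) / (ζ4 - ζ6);
        0, (ζ4 - ζ2) / (ζ4 - ζ6), (ζ2 - ζ6) / (ζ4 - ζ6);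
        0, (ζ4 - ζ1) / (ζ4 - ζ6), (ζ1 - ζ6) / (ζ4 - ζ6)] : Matrix (Fin 4) (Fin 3) F) =
    (!![1, 0, 0, 0, 0;
        0, (ζ4 - ζ5) / (ζ4 - ζ6), (ζ5 - ζ6) / (ζ4 - ζ6), 0, 0;
        0, (ζ4 - ζ3) / (ζ4 - ζ6), (ζ3 - ζ6) / (ζ4 - ζ6), 0, 0;
        0, 0, 0, 1, 0;
        0, 0, 0, 0, 1;
        0, (ζ4 - ζ1) / (ζ4 - ζ6), (ζ1 - ζ6) / (ζ4 - ζ6), 0, 0] : Matrix (Fin 6) (Fin 5) F) *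
    (!![(ζ3 - ζ5) / (ζ3 - ζ6), (ζ5 - ζ6) / (ζ3 - ζ6), 0, 0;
        0, 0, 1, 0;
        (ζ3 - ζ2) / (ζ3 - ζ6), (ζ2 - ζ6) / (ζ3 - ζ6), 0, 0;
        0, 0, 0, 1;
        (ζ3 - ζ1) / (ζ3 - ζ6), (ζ1 - ζ6) / (ζ3 - ζ6), 0, 0] : Matrix (Fin 5) (Fin 4) F) *
    (!![(ζ3 - ζ4) / (ζ3 - ζ5), (ζ4 - ζ5) / (ζ3 - ζ5), 0;
        0, 0, 1;
        (ζ3 - ζ2) / (ζ3 - ζ5), (ζ2 - ζ5) / (ζ3 - ζ5), 0;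
        (ζ3 - ζ1) / (ζ3 - ζ5), (ζ1 - ζ5) / (ζ3 - ζ5), 0] : Matrix (Fin 4) (Fin 3) F) := by
  have h35' : ζ3 - ζ5 ≠ 0 := sub_ne_zero.mpr h35
  have h36' : ζ3 - ζ6 ≠ 0 := sub_ne_zero.mpr h36
  have h46' : ζ4 - ζ6 ≠ 0 := sub_ne_zero.mpr h46
  ext i j
  fin_cases i <;> fin_cases j <;>
    simp [Matrix.mul_apply, Fin.sum_univ_succ] <;>
    field_simp <;> ring
end

section
/- For a triangle, i.e. a 3-element subset {p,q,r} of {1,2,3,4} with p < q < r, let f(pqr) ∈ F^4 be the vector whose p-th component is 1/((ζ_p−ζ_q)(ζ_p−ζ_r)), whose q-th component is 1/((ζ_q−ζ_p)(ζ_q−ζ_r)), whose r-th component is 1/((ζ_r−ζ_p)(ζ_r−ζ_q)), and whose remaining component is 0. Then the 2×2 matrix P_{24,13} = [[(ζ_2−ζ_3)/(ζ_2−ζ_4), (ζ_3−ζ_4)/(ζ_2−ζ_4)], [(ζ_2−ζ_1)/(ζ_2−ζ_4), (ζ_1−ζ_4)/(ζ_2−ζ_4)]] satisfies: the first row applied to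 the pair (f(123), f(134)) gives f(124), and the second row gives f(234); that is, P_{24,13} times the 2×4 matrix with rows f(123) and f(134) equals the 2×4 matrix with rows f(124) and f(234). -/
/-- the matrix `P_{24,13}` of the Pachner 2-2 move sends the pair of
vectors `(f(123), f(134))` (rows of a `2×4` matrix) to the pair `(f(124), f(234))`. -/
theorem stmt_10 (F : Type*) [Field F] (ζ1 ζ2 ζ3 ζ4 : F)
    (h12 : ζ1 ≠ ζ2) (h13 : ζ1 ≠ ζ3) (h14 : ζ1 ≠ ζ4)
    (h23 : ζ2 ≠ ζ3) (h24 : ζ2 ≠ ζ4) (h34 : ζ3 ≠ ζ4) :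
    (!![(ζ2 - ζ3) / (ζ2 - ζ4), (ζ3 - ζ4) / (ζ2 - ζ4);
        (ζ2 - ζ1) / (ζ2 - ζ4), (ζ1 - ζ4) / (ζ2 - ζ4)] : Matrix (Fin 2) (Fin 2) F) *
    (!![1 / ((ζ1 - ζ2) * (ζ1 - ζ3)), 1 / ((ζ2 - ζ1) * (ζ2 - ζ3)),
          1 / ((ζ3 - ζ1) * (ζ3 - ζ2)), 0;
        1 / ((ζ1 - ζ3) * (ζ1 - ζ4)), 0,
          1 / ((ζ3 - ζ1) * (ζ3 - ζ4)), 1 / ((ζ4 - ζ1) * (ζ4 - ζ3))] :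
      Matrix (Fin 2) (Fin 4) F) =
    (!![1 / ((ζ1 - ζ2) * (ζ1 - ζ4)), 1 / ((ζ2 - ζ1) * (ζ2 - ζ4)), 0,
          1 / ((ζ4 - ζ1) * (ζ4 - ζ2));
        0, 1 / ((ζ2 - ζ3) * (ζ2 - ζ4)), 1 / ((ζ3 - ζ2) * (ζ3 - ζ4)),
          1 / ((ζ4 - ζ2) * (ζ4 - ζ3))] : Matrix (Fin 2) (Fin 4) F) := by
  have d12 := sub_ne_zero.2 h12
  have d13 := sub_ne_zero.2 h13
  have d14 := sub_ne_zero.2 h14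
  have d23 := sub_ne_zero.2 h23
  have d24 := sub_ne_zero.2 h24
  have d34 := sub_ne_zero.2 h34
  rw [← neg_sub ζ1 ζ2, ← neg_sub ζ1 ζ3, ← neg_sub ζ1 ζ4, ← neg_sub ζ2 ζ3, ← neg_sub ζ2 ζ4,
    ← neg_sub ζ3 ζ4]
  ext i j
  fin_cases i <;> fin_cases j <;> simp [Matrix.mul_apply, -neg_sub] <;> field_simp <;> ring
end

section
/- For a tetrahedron, i.e. a 4-element subset {p,q,r,s} of {1,…,5} with p < q < r < s, let f(pqrs) ∈ F^5 be the vector whose component at each vertex v ∈ {p,q,r,s} is 1/∏_{w ∈ {p,q,r,s}, w ≠ v}(ζ_v − ζ_w) and whose remaining component is 0. Then the 3×2 matrix P_{13,245} = [[(ζ_1−ζ_5)/(ζ_1−ζ_3), (ζ_5−ζ_3)/(ζ_1−ζ_3)], [(ζ_1−ζ_4)/(ζ_1−ζ_3), (ζ_4−ζ_3)/(ζ_1−ζ_3)], [(ζ_1−ζ_2)/(ζ_1−ζ_3), (ζ_2−ζ_3)/(ζ_1−ζ_3)]] satisfies: P_{13,245} times the 2×5 matrix with rows f(1245) and f(2345)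 equals the 3×5 matrix with rows f(1234), f(1235), f(1345). -/
set_option maxHeartbeats 2000000 in
/-- the matrix `P_{13,245}` of the Pachner 2-3 move sends the pair of
vectors `(f(1245), f(2345))` (rows of a `2×5` matrix) to the triple
`(f(1234), f(1235), f(1345))` (rows of a `3×5` matrix). -/
theorem stmt_11 (F : Type*) [Field F] (ζ1 ζ2 ζ3 ζ4 ζ5 : F)
    (h12 : ζ1 ≠ ζ2) (h13 : ζ1 ≠ ζ3) (h14 : ζ1 ≠ ζ4) (h15 : ζ1 ≠ ζ5)
    (h23 : ζ2 ≠ ζ3) (h24 : ζ2 ≠ ζ4) (h25 : ζ2 ≠ ζ5)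
    (h34 : ζ3 ≠ ζ4) (h35 : ζ3 ≠ ζ5) (h45 : ζ4 ≠ ζ5) :
    (!![(ζ1 - ζ5) / (ζ1 - ζ3), (ζ5 - ζ3) / (ζ1 - ζ3);
        (ζ1 - ζ4) / (ζ1 - ζ3), (ζ4 - ζ3) / (ζ1 - ζ3);
        (ζ1 - ζ2) / (ζ1 - ζ3), (ζ2 - ζ3) / (ζ1 - ζ3)] : Matrix (Fin 3) (Fin 2) F) *
    (!![1 / ((ζ1 - ζ2) * ((ζ1 - ζ4) * (ζ1 - ζ5))),
          1 / ((ζ2 - ζ1) * ((ζ2 - ζ4) * (ζ2 - ζ5))), 0,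
          1 / ((ζ4 - ζ1) * ((ζ4 - ζ2) * (ζ4 - ζ5))),
          1 / ((ζ5 - ζ1) * ((ζ5 - ζ2) * (ζ5 - ζ4)));
        0, 1 / ((ζ2 - ζ3) * ((ζ2 - ζ4) * (ζ2 - ζ5))),
          1 / ((ζ3 - ζ2) * ((ζ3 - ζ4) * (ζ3 - ζ5))),
          1 / ((ζ4 - ζ2) * ((ζ4 - ζ3) * (ζ4 - ζ5))),
          1 / ((ζ5 - ζ2) * ((ζ5 - ζ3) * (ζ5 - ζ4)))] : Matrix (Fin 2) (Fin 5) F) =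
    (!![1 / ((ζ1 - ζ2) * ((ζ1 - ζ3) * (ζ1 - ζ4))),
          1 / ((ζ2 - ζ1) * ((ζ2 - ζ3) * (ζ2 - ζ4))),
          1 / ((ζ3 - ζ1) * ((ζ3 - ζ2) * (ζ3 - ζ4))),
          1 / ((ζ4 - ζ1) * ((ζ4 - ζ2) * (ζ4 - ζ3))), 0;
        1 / ((ζ1 - ζ2) * ((ζ1 - ζ3) * (ζ1 - ζ5))),
          1 / ((ζ2 - ζ1) * ((ζ2 - ζ3) * (ζ2 - ζ5))),
          1 / ((ζ3 - ζ1) * ((ζ3 - ζ2) * (ζ3 - ζ5))), 0,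
          1 / ((ζ5 - ζ1) * ((ζ5 - ζ2) * (ζ5 - ζ3)));
        1 / ((ζ1 - ζ3) * ((ζ1 - ζ4) * (ζ1 - ζ5))), 0,
          1 / ((ζ3 - ζ1) * ((ζ3 - ζ4) * (ζ3 - ζ5))),
          1 / ((ζ4 - ζ1) * ((ζ4 - ζ3) * (ζ4 - ζ5))),
          1 / ((ζ5 - ζ1) * ((ζ5 - ζ3) * (ζ5 - ζ4)))] : Matrix (Fin 3) (Fin 5) F) := by
  rw [← sub_ne_zero] at h12 h13 h14 h15 h23 h24 h25 h34 h35 h45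
  -- Orient every difference the same way, so that each one is known to be nonzero.
  rw [← neg_sub ζ1 ζ2, ← neg_sub ζ1 ζ3, ← neg_sub ζ1 ζ4, ← neg_sub ζ1 ζ5, ← neg_sub ζ2 ζ3,
    ← neg_sub ζ2 ζ4, ← neg_sub ζ2 ζ5, ← neg_sub ζ3 ζ4, ← neg_sub ζ3 ζ5, ← neg_sub ζ4 ζ5]
  ext i j
  fin_cases i <;> fin_cases j <;> simp [Matrix.mul_apply, Fin.sum_univ_two, -neg_sub] <;>
    field_simp <;> ring
end

section
/- For a 4-simplex, i.e. a 5-element subset {p,q,r,s,t} of {1,…,6}, let f(pqrst) ∈ F^6 be the vector whose component at each vertex v of the 4-simplex is (4ζ_v − ∑_{w ≠ v} ζ_w)/∏_{w ≠ v}(ζ_v − ζ_w), where w runs over the other four vertices, and whose remaining component is 0. Let V(i,j,k) = (ζ_j−ζ_i)(ζ_k−ζ_i)(ζ_k−ζ_j) denote the 3×3 Vandermonde determinant. Then the 3×3 matrix P_{246,135} = [[V(2,4,5)/V(2,4,6), V(2,5,6)/V(2,4,6), V(5,4,6)/V(2,4,6)], [V(2,4,3)/V(2,4,6), V(2,3,6)/V(2,4,6),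 V(3,4,6)/V(2,4,6)], [V(2,4,1)/V(2,4,6), V(2,1,6)/V(2,4,6), V(1,4,6)/V(2,4,6)]] satisfies: P_{246,135} times the 3×6 matrix with rows f(12345), f(12356), f(13456) equals the 3×6 matrix with rows f(12346), f(12456), f(23456). Here V(i,j,k) for a non-increasing triple (i,j,k) is understood via the same formula V(i,j,k) = (ζ_j−ζ_i)(ζ_k−ζ_i)(ζ_k−ζ_j). -/
/-- The vector `f(pqrst) ∈ F^6` associated to the 4-simplex obtained by omitting the
vertex `r` from `{1,…,6}`: its component at a vertex `v ≠ r` is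
`(4ζ_v − ∑_{w ≠ v} ζ_w)/∏_{w ≠ v}(ζ_v − ζ_w)` (with `w` running over the other four
vertices of the simplex), and its component at `r` is `0`. -/
def fsimp {F : Type*} [Field F] (z : Fin 6 → F) (r : Fin 6) : Fin 6 → F :=
  fun v => if v = r then 0 else
    (4 * z v - ∑ w ∈ (Finset.univ.erase r).erase v, z w) /
      ∏ w ∈ (Finset.univ.erase r).erase v, (z v - z w)

/-- The Vandermonde determinant `V(i,j,k) = (ζ_j − ζ_i)(ζ_k − ζ_i)(ζ_k − ζ_j)`. -/
def Vd {F : Type*} [Field F] (z : Fin 6 → F) (i j k : Fin 6) : F :=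
  (z j - z i) * (z k - z i) * (z k - z j)

/-- The components of `f` are quadratic in the coordinate of the omitted vertex. -/
lemma fsimp_eq_quadratic {F : Type*} [Field F] {z : Fin 6 → F} (hz : Function.Injective z)
    (r v : Fin 6) :
    fsimp z r v = (5 * z v - ∑ w, z w + z r) * (z v - z r) /
      ∏ w ∈ Finset.univ.erase v, (z v - z w) := by
  unfold fsimp
  split_ifs with h
  · simp [h]
  · have hv : v ∈ Finset.univ.erase r := by simp [h]
    have hr : r ∈ Finset.univ.erase v := by simp [Ne.symm h]
    have hne : z v - z r ≠ 0 := sub_ne_zero.mpr (hz.ne h)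
    have hsum : ∑ w, z w = z r + (z v + ∑ w ∈ (Finset.univ.erase r).erase v, z w) := by
      rw [Finset.add_sum_erase _ _ hv, Finset.add_sum_erase _ _ (Finset.mem_univ r)]
    rw [hsum, ← Finset.mul_prod_erase _ _ hr, Finset.erase_right_comm,
      mul_comm _ (z v - z r), mul_div_mul_left _ _ hne]
    congr 1
    ring

/-- Lagrange interpolation of the components of `f` at the three nodes `z i`, `z j`, `z k`. -/
lemma fsimp_interpolation {F : Type*} [Field F] {z : Fin 6 → F} (hz : Function.Injective z)
    {i j k : Fin 6} (hij : i ≠ j) (hik : i ≠ k) (hjk : j ≠ k) (r v : Fin 6) :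
    Vd z i j r / Vd z i j k * fsimp z k v + Vd z i r k / Vd z i j k * fsimp z j v +
      Vd z r j k / Vd z i j k * fsimp z i v = fsimp z r v := by
  have hV : Vd z i j k ≠ 0 :=
    mul_ne_zero (mul_ne_zero (sub_ne_zero.mpr (hz.ne hij.symm))
      (sub_ne_zero.mpr (hz.ne hik.symm))) (sub_ne_zero.mpr (hz.ne hjk.symm))
  simp only [fsimp_eq_quadratic hz, div_mul_eq_mul_div, ← add_div, ← mul_div_assoc]
  congr 1
  rw [div_eq_iff hV]
  unfold Vd
  ring

/-- the matrix `P_{246,135}` of the Pachner 3-3 move sends the triple of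
vectors `(f(12345), f(12356), f(13456))` to the triple `(f(12346), f(12456), f(23456))`.
(Vertices `1,…,6` are `0,…,5` in `Fin 6`.) -/
theorem stmt_12 (F : Type*) [Field F] [CharZero F]
    (z : Fin 6 → F) (hz : Function.Injective z) :
    (!![Vd z 1 3 4 / Vd z 1 3 5, Vd z 1 4 5 / Vd z 1 3 5, Vd z 4 3 5 / Vd z 1 3 5;
        Vd z 1 3 2 / Vd z 1 3 5, Vd z 1 2 5 / Vd z 1 3 5, Vd z 2 3 5 / Vd z 1 3 5;
        Vd z 1 3 0 / Vd z 1 3 5, Vd z 1 0 5 / Vd z 1 3 5, Vd z 0 3 5 / Vd z 1 3 5] :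
      Matrix (Fin 3) (Fin 3) F) *
    Matrix.of ![fsimp z 5, fsimp z 3, fsimp z 1] =
    Matrix.of ![fsimp z 4, fsimp z 2, fsimp z 0] := by
  ext a v
  fin_cases a <;>
    simpa [Matrix.mul_apply, Fin.sum_univ_three] using
      fsimp_interpolation hz (i := 1) (j := 3) (k := 5) (by decide) (by decide) (by decide) _ v
end

section
/- Define f(i,j,k,l,m) = (4ζ_i − ζ_j − ζ_k − ζ_l − ζ_m)/((ζ_i−ζ_j)(ζ_i−ζ_k)(ζ_i−ζ_l)(ζ_i−ζ_m)). Let m be the 6×6 matrix over F whose (r,c)-entry is 0 if r = c and equals f(c, i_1, i_2, i_3, i_4) otherwise, where {i_1, i_2, i_3, i_4} = {1,…,6}∖{r,c}; that is, the r-th row of m is the vector whose c-th component (c ≠ r) is f evaluated at vertex c of the 4-simplex with vertex set {1,…,6}∖{r}. Then the rank of m is exactly 3. -/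
/-- Over the common denominator `∏_{w ≠ c} (ζ_c − ζ_w)`, the entry in row `r` and column `c` has
numerator `(5ζ_c + ζ_r − ∑ ζ_w)(ζ_c − ζ_r)`. -/
lemma fsimp_eq_div {F : Type*} [Field F] {z : Fin 6 → F} (hz : Function.Injective z)
    (r c : Fin 6) :
    fsimp z r c = (5 * z c + z r - ∑ w, z w) * (z c - z r) /
      ∏ w ∈ Finset.univ.erase c, (z c - z w) := by
  unfold fsimp
  split_ifs with h
  · simp [h]
  · have hr : r ∈ Finset.univ.erase c := by simp [Ne.symm h]
    have hc : c ∈ Finset.univ.erase r := by simp [h]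
    have hne : z c - z r ≠ 0 := sub_ne_zero.2 (hz.ne h)
    rw [← Finset.mul_prod_erase _ _ hr, mul_comm _ (z c - z r), mul_div_mul_left _ _ hne,
      Finset.erase_right_comm, ← Finset.add_sum_erase _ z (Finset.mem_univ r),
      ← Finset.add_sum_erase _ z hc, Finset.erase_right_comm]
    congr 1
    ring

/-- Any submatrix of the matrix of `f`-values factors as a Vandermonde matrix with rows
`(1, ζ_r, ζ_r²)`, a constant `3×3` matrix, a transposed Vandermonde matrix and a diagonal matrix. -/
lemma submatrix_of_fsimp_eq_mul {F : Type*} [Field F] {z : Fin 6 → F}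
    (hz : Function.Injective z) {n : ℕ} (e : Fin n → Fin 6) :
    (Matrix.of (fun r c => fsimp z r c) : Matrix (Fin 6) (Fin 6) F).submatrix e e =
      Matrix.of (fun r (k : Fin 3) => z (e r) ^ (k : ℕ)) *
        (!![0, -∑ w, z w, 5; ∑ w, z w, -4, 0; -1, 0, 0] *
          (Matrix.of (fun r (k : Fin 3) => z (e r) ^ (k : ℕ))).transpose *
          Matrix.diagonal fun c => (∏ w ∈ Finset.univ.erase (e c), (z (e c) - z w))⁻¹) := by
  ext r c
  rw [← Matrix.mul_assoc, Matrix.mul_diagonal, Matrix.submatrix_apply, Matrix.of_apply,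
    fsimp_eq_div hz, div_eq_mul_inv]
  congr 1
  generalize ∑ w, z w = S
  simp only [Matrix.mul_apply, Fin.sum_univ_three, Matrix.transpose_apply, Matrix.of_apply]
  simp
  ring

/-- the `6×6` matrix `m` whose `(r,c)`-entry is `0` if `r = c` and
`f(c, i₁, i₂, i₃, i₄)` otherwise (where `{i₁,i₂,i₃,i₄} = {1,…,6}∖{r,c}`) has rank
exactly `3`. -/
theorem stmt_13 (F : Type*) [Field F] [CharZero F]
    (z : Fin 6 → F) (hz : Function.Injective z) :
    (Matrix.of (fun r c => fsimp z r c) : Matrix (Fin 6) (Fin 6) F).rank = 3 := by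
  apply le_antisymm
  · rw [← Matrix.submatrix_id_id (Matrix.of _), submatrix_of_fsimp_eq_mul hz id]
    exact (Matrix.rank_mul_le_left _ _).trans (Matrix.rank_le_width _)
  · have he : Function.Injective (z ∘ Fin.castLE (by norm_num : 3 ≤ 6)) :=
      hz.comp (Fin.castLE_injective _)
    have hV : (Matrix.vandermonde (z ∘ Fin.castLE (by norm_num : 3 ≤ 6))).det ≠ 0 :=
      Matrix.det_vandermonde_ne_zero_iff.2 he
    refine le_trans (le_of_eq ?_) (Matrix.rank_submatrix_le _
      (Fin.castLE (by norm_num : 3 ≤ 6)) (Fin.castLE (by norm_num : 3 ≤ 6)))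
    rw [Matrix.rank_of_det_ne_zero, Fintype.card_fin]
    rw [submatrix_of_fsimp_eq_mul hz, Matrix.det_mul, Matrix.det_mul, Matrix.det_mul,
      Matrix.det_transpose, Matrix.det_diagonal]
    refine mul_ne_zero hV (mul_ne_zero (mul_ne_zero ?_ hV) ?_)
    · simp [Matrix.det_fin_three]
    · refine Finset.prod_ne_zero_iff.2 fun c _ => inv_ne_zero (Finset.prod_ne_zero_iff.2 ?_)
      exact fun w hw => sub_ne_zero.2 (hz.ne (Finset.ne_of_mem_erase hw).symm)
end
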